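/- arXiv:1803.09532 — 2 statements merged into one kernel-verified Lean document; each statement's English description precedes it below -/
import Mathlib

section
/- For every integer n ≥ 0 and every real x, the probabilists' Hermite polynomials satisfy H_n(x)² ≤ K² · n! · e^{x²/2} with the constant K = 1.087. -/
/-- Probabilists' Hermite polynomial evaluated at a real number. -/
noncomputable def H (n : ℕ) (x : ℝ) : ℝ := Polynomial.aeval x (Polynomial.hermite n)

theorem Polynomial.derivative_hermite_succ (n : ℕ) :
    Polynomial.derivative (Polynomial.hermite (n + 1)) =
      ((n + 1 : ℕ) : Polynomial ℤ) * Polynomial.hermite n := by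
  induction n with
  | zero => simp
  | succ n ih =>
    rw [Polynomial.hermite_succ (n + 1), ih]
    simp only [Polynomial.derivative_sub, Polynomial.derivative_mul, Polynomial.derivative_X,
      Polynomial.derivative_natCast, ih]
    rw [Polynomial.hermite_succ n]
    push_cast
    ring

/-- The derivative of the Hermite polynomial `H n`. -/
noncomputable def hermiteDeriv (n : ℕ) (x : ℝ) : ℝ :=
  Polynomial.aeval x (Polynomial.derivative (Polynomial.hermite n))

theorem hasDerivAt_H (n : ℕ) (x : ℝ) : HasDerivAt (H n) (hermiteDeriv n x) x :=
  Polynomial.hasDerivAt_aeval _ x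

theorem H_succ (n : ℕ) (x : ℝ) : H (n + 1) x = x * H n x - hermiteDeriv n x := by
  simp [H, hermiteDeriv, Polynomial.hermite_succ]

theorem hermiteDeriv_succ (n : ℕ) (x : ℝ) : hermiteDeriv (n + 1) x = (n + 1) * H n x := by
  rw [hermiteDeriv, Polynomial.derivative_hermite_succ]
  simp [H]

theorem H_zero (x : ℝ) : H 0 x = 1 := by simp [H]

theorem hermiteDeriv_zero (x : ℝ) : hermiteDeriv 0 x = 0 := by simp [hermiteDeriv]

theorem H_add_two (n : ℕ) (x : ℝ) : H (n + 2) x = x * H (n + 1) x - (n + 1) * H n x := by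
  rw [H_succ, hermiteDeriv_succ]

theorem H_neg (n : ℕ) (x : ℝ) : H n (-x) = (-1) ^ n * H n x := by
  induction n using Nat.twoStepInduction with
  | zero => simp [H_zero]
  | one => simp [H]
  | more n h₀ h₁ =>
    rw [H_add_two, H_add_two, h₀, h₁]
    ring

theorem hasDerivAt_hermiteDeriv (n : ℕ) (x : ℝ) :
    HasDerivAt (hermiteDeriv n) (x * hermiteDeriv n x - n * H n x) x := by
  cases n with
  | zero =>
    rw [show hermiteDeriv 0 = fun _ => 0 from funext hermiteDeriv_zero]
    simpa using hasDerivAt_const x (0 : ℝ)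
  | succ n =>
    rw [show hermiteDeriv (n + 1) = fun x => ((n : ℝ) + 1) * H n x from
      funext (hermiteDeriv_succ n)]
    refine ((hasDerivAt_H n x).const_mul ((n : ℝ) + 1)).congr_deriv ?_
    rw [H_succ]
    push_cast
    ring

/-- Nonnegativity of the Christoffel–Darboux form of the Hermite polynomials. -/
theorem christoffel_nonneg (n : ℕ) (x : ℝ) :
    0 ≤ hermiteDeriv n x ^ 2 - x * H n x * hermiteDeriv n x + n * H n x ^ 2 := by
  induction n with
  | zero => simp [hermiteDeriv_zero]
  | succ n ih =>
    rw [hermiteDeriv_succ, H_succ]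
    have h : 0 ≤ ((n : ℝ) + 1) * (hermiteDeriv n x ^ 2 - x * H n x * hermiteDeriv n x +
        n * H n x ^ 2 + H n x ^ 2) := by positivity
    push_cast
    linarith

/-- The Hermite function, up to normalization. -/
noncomputable def hermiteFun (n : ℕ) (x : ℝ) : ℝ := H n x * Real.exp (-(x ^ 2 / 4))

/-- The derivative of the Hermite function. -/
noncomputable def hermiteFunDeriv (n : ℕ) (x : ℝ) : ℝ :=
  (hermiteDeriv n x - x / 2 * H n x) * Real.exp (-(x ^ 2 / 4))

theorem hasDerivAt_exp_neg_sq_div_four (x : ℝ) :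
    HasDerivAt (fun x : ℝ => Real.exp (-(x ^ 2 / 4))) (Real.exp (-(x ^ 2 / 4)) * (-(x / 2))) x := by
  refine (((hasDerivAt_pow 2 x).div_const 4).neg).exp.congr_deriv ?_
  simp only [Pi.neg_apply]
  push_cast
  ring

theorem hasDerivAt_hermiteFun (n : ℕ) (x : ℝ) :
    HasDerivAt (hermiteFun n) (hermiteFunDeriv n x) x := by
  refine ((hasDerivAt_H n x).mul (hasDerivAt_exp_neg_sq_div_four x)).congr_deriv ?_
  rw [hermiteFunDeriv]
  ring

theorem hasDerivAt_hermiteFunDeriv (n : ℕ) (x : ℝ) :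
    HasDerivAt (hermiteFunDeriv n) ((x ^ 2 / 4 - (n + 1 / 2)) * hermiteFun n x) x := by
  refine (((hasDerivAt_hermiteDeriv n x).sub
    (((hasDerivAt_id x).div_const 2).mul (hasDerivAt_H n x))).mul
    (hasDerivAt_exp_neg_sq_div_four x)).congr_deriv ?_
  simp only [hermiteFun, Pi.sub_apply, Pi.mul_apply, id]
  ring

theorem half_sq_hermiteFun_le (n : ℕ) (x : ℝ) :
    hermiteFun n x ^ 2 / 2 ≤
      hermiteFunDeriv n x ^ 2 + ((n + 1 / 2 : ℝ) - x ^ 2 / 4) * hermiteFun n x ^ 2 := by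
  have h := mul_nonneg (christoffel_nonneg n x) (sq_nonneg (Real.exp (-(x ^ 2 / 4))))
  simp only [hermiteFun, hermiteFunDeriv]
  linarith

theorem sq_hermiteFun (n : ℕ) (x : ℝ) :
    hermiteFun n x ^ 2 = H n x ^ 2 / Real.exp (x ^ 2 / 2) := by
  rw [hermiteFun, mul_pow, ← Real.exp_nat_mul, div_eq_mul_inv (H n x ^ 2), ← Real.exp_neg]
  congr 2
  push_cast
  ring

theorem sq_hermiteFun_neg (n : ℕ) (x : ℝ) : hermiteFun n (-x) ^ 2 = hermiteFun n x ^ 2 := by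
  rw [sq_hermiteFun, sq_hermiteFun, H_neg, mul_pow, ← pow_mul, mul_comm n 2, pow_mul]
  simp

open Filter Topology in
theorem tendsto_sq_hermiteFun_atTop (n : ℕ) :
    Tendsto (fun x => hermiteFun n x ^ 2) atTop (𝓝 0) := by
  have h := Polynomial.tendsto_div_exp_atTop
    (((Polynomial.hermite n).map (algebraMap ℤ ℝ)) ^ 2)
  refine squeeze_zero' (Eventually.of_forall fun x => sq_nonneg _) ?_ h
  filter_upwards [eventually_ge_atTop 2] with x hx
  rw [sq_hermiteFun, Polynomial.eval_pow, Polynomial.eval_map_algebraMap, H]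
  gcongr
  nlinarith

open Filter Topology in
theorem tendsto_sq_hermiteFun_cocompact (n : ℕ) :
    Tendsto (fun x => hermiteFun n x ^ 2) (cocompact ℝ) (𝓝 0) := by
  rw [cocompact_eq_atBot_atTop, tendsto_sup]
  refine ⟨?_, tendsto_sq_hermiteFun_atTop n⟩
  have h := (tendsto_sq_hermiteFun_atTop n).comp tendsto_neg_atBot_atTop
  simpa [Function.comp_def, sq_hermiteFun_neg] using h

theorem continuous_hermiteFun (n : ℕ) : Continuous (hermiteFun n) :=
  continuous_iff_continuousAt.2 fun x => (hasDerivAt_hermiteFun n x).continuousAt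

theorem exists_nonneg_max_hermiteFun (n : ℕ) {x : ℝ} (hx : hermiteFun n x ≠ 0) :
    ∃ ξ, 0 ≤ ξ ∧ ∀ t, hermiteFun n t ^ 2 ≤ hermiteFun n ξ ^ 2 := by
  obtain ⟨ξ, hξ⟩ := ((continuous_hermiteFun n).pow 2).exists_forall_ge' x
    (((tendsto_sq_hermiteFun_cocompact n).eventually_lt_const (sq_pos_of_ne_zero hx)).mono
      fun _ h => h.le)
  rcases le_total 0 ξ with h | h
  · exact ⟨ξ, h, hξ⟩
  · exact ⟨-ξ, by linarith, fun t => by rw [sq_hermiteFun_neg]; exact hξ t⟩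

theorem hermiteFunDeriv_eq_zero_of_max {n : ℕ} {ξ : ℝ} (h₀ : hermiteFun n ξ ≠ 0)
    (hξ : ∀ t, hermiteFun n t ^ 2 ≤ hermiteFun n ξ ^ 2) : hermiteFunDeriv n ξ = 0 := by
  have hmax : IsLocalMax (fun t => hermiteFun n t ^ 2) ξ := Filter.Eventually.of_forall hξ
  have h := hmax.hasDerivAt_eq_zero ((hasDerivAt_hermiteFun n ξ).pow 2)
  simpa [h₀] using h

theorem le_of_hasDerivAt_nonpos {f f' : ℝ → ℝ} {a b : ℝ} (hab : a ≤ b)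
    (hf : ∀ x ∈ Set.Icc a b, HasDerivAt f (f' x) x) (hf' : ∀ x ∈ Set.Icc a b, f' x ≤ 0) :
    f b ≤ f a := by
  refine antitoneOn_of_hasDerivWithinAt_nonpos (convex_Icc a b)
    (fun x hx => (hf x hx).continuousAt.continuousWithinAt)
    (fun x hx => (hf x (interior_subset hx)).hasDerivWithinAt)
    (fun x hx => hf' x (interior_subset hx)) (Set.left_mem_Icc.2 hab) (Set.right_mem_Icc.2 hab) hab

/-- A global maximum of a solution of `y'' = (x² / 4 - N) y` with positive energy cannot be too
close to the turning point `2 √N`. -/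
theorem three_mul_le_of_max_pos {y z : ℝ → ℝ} {N ξ : ℝ} (hy : ∀ x, HasDerivAt y (z x) x)
    (hz : ∀ x, HasDerivAt z ((x ^ 2 / 4 - N) * y x) x)
    (hS : ∀ x, y x ^ 2 / 2 ≤ z x ^ 2 + (N - x ^ 2 / 4) * y x ^ 2) (hξ : 0 ≤ ξ)
    (hpos : 0 < y ξ) (hmax : ∀ x, y x ^ 2 ≤ y ξ ^ 2) (hzξ : z ξ = 0) :
    3 * N ≤ 8 * (N - ξ ^ 2 / 4) ^ 3 + 3 * (N - ξ ^ 2 / 4) := by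
  set M := y ξ with hM
  obtain ⟨Δ, hΔ⟩ : ∃ Δ, Δ = N - ξ ^ 2 / 4 := ⟨_, rfl⟩
  rw [← hΔ]
  have hΔpos : 0 < Δ := by
    have h := hS ξ
    rw [hzξ, ← hΔ, ← hM] at h
    have : 0 < M ^ 2 := by positivity
    nlinarith
  have habs : ∀ x, |y x| ≤ M := fun x => abs_le_of_sq_le_sq (hmax x) hpos.le
  obtain ⟨b, hb₀, hb⟩ : ∃ b, 0 ≤ b ∧ b ^ 2 = ξ ^ 2 + 8 * Δ :=
    ⟨√(ξ ^ 2 + 8 * Δ), by positivity, Real.sq_sqrt (by positivity)⟩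
  have hξb : ξ ≤ b := by nlinarith
  have hz' : ∀ x ∈ Set.Icc ξ b, -Δ * M * (x - ξ) ≤ z x := by
    intro x hx
    have h := le_of_hasDerivAt_nonpos (f := fun t => -Δ * M * (t - ξ) - z t) hx.1
      (fun t _ => (((hasDerivAt_id t).sub_const ξ).const_mul (-Δ * M)).sub (hz t)) ?_
    · simp only [hzξ] at h
      linarith
    · intro t ht
      have h₁ : ξ ^ 2 ≤ t ^ 2 := by nlinarith [ht.1]
      have h₂ : t ^ 2 ≤ b ^ 2 := by nlinarith [ht.1, ht.2, hx.2]
      have h₃ : |t ^ 2 / 4 - N| ≤ Δ := abs_le.2 ⟨by linarith, by linarith⟩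
      have h₄ : |(t ^ 2 / 4 - N) * y t| ≤ Δ * M := by
        rw [abs_mul]
        exact mul_le_mul h₃ (habs t) (abs_nonneg _) hΔpos.le
      linarith [(abs_le.1 h₄).1]
  have hy' : ∀ x ∈ Set.Icc ξ b, M * (1 - Δ * (x - ξ) ^ 2 / 2) ≤ y x := by
    intro x hx
    have h := le_of_hasDerivAt_nonpos (f := fun t => M * (1 - Δ * (t - ξ) ^ 2 / 2) - y t)
      (f' := fun t => -Δ * M * (t - ξ) - z t) hx.1 (fun t _ => ?_) ?_
    · simp only [← hM] at h
      linarith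
    · refine ((((((((hasDerivAt_id t).sub_const ξ).pow 2).const_mul Δ).div_const
        2).const_sub 1).const_mul M).sub (hy t)).congr_deriv ?_
      simp
      ring
    · intro t ht
      linarith [hz' t ⟨ht.1, ht.2.trans hx.2⟩]
  have hysq : ∀ x ∈ Set.Icc ξ b,
      M ^ 2 * (ξ ^ 2 - 4 * Δ * ((x ^ 2 - ξ ^ 2) / 4) ^ 2) ≤ ξ ^ 2 * y x ^ 2 := by
    intro x hx
    have h₁ : M ^ 2 * (1 - Δ * (x - ξ) ^ 2) ≤ y x ^ 2 := by
      rcases le_total 0 (1 - Δ * (x - ξ) ^ 2 / 2) with h | h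
      · have h₂ := pow_le_pow_left₀ (mul_nonneg hpos.le h) (hy' x hx) 2
        have h₃ : 0 ≤ (M * (Δ * (x - ξ) ^ 2 / 2)) ^ 2 := sq_nonneg _
        nlinarith
      · nlinarith [sq_nonneg (y x), sq_nonneg M, mul_nonneg hΔpos.le (sq_nonneg (x - ξ))]
    have h₂ : ξ ^ 2 * (x - ξ) ^ 2 ≤ 4 * ((x ^ 2 - ξ ^ 2) / 4) ^ 2 := by
      have h₃ : ξ * (x - ξ) ≤ 2 * ((x ^ 2 - ξ ^ 2) / 4) := by nlinarith [sq_nonneg (x - ξ)]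
      have h₄ := pow_le_pow_left₀ (mul_nonneg hξ (sub_nonneg.2 hx.1)) h₃ 2
      nlinarith
    have h₅ := mul_le_mul_of_nonneg_left h₁ (sq_nonneg ξ)
    have h₆ := mul_le_mul_of_nonneg_left h₂ (mul_nonneg (sq_nonneg M) hΔpos.le)
    nlinarith
  have hfin := le_of_hasDerivAt_nonpos
    (f := fun t => ξ ^ 2 * (z t ^ 2 + (N - t ^ 2 / 4) * y t ^ 2) +
      M ^ 2 * (ξ ^ 2 * ((t ^ 2 - ξ ^ 2) / 4) - 4 * Δ / 3 * ((t ^ 2 - ξ ^ 2) / 4) ^ 3))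
    (f' := fun t => t / 2 * (M ^ 2 * (ξ ^ 2 - 4 * Δ * ((t ^ 2 - ξ ^ 2) / 4) ^ 2) -
      ξ ^ 2 * y t ^ 2)) hξb (fun t _ => ?_) ?_
  · simp only [hzξ, ← hM, hb, ← hΔ] at hfin
    have h₁ := mul_nonneg (sq_nonneg ξ)
      ((div_nonneg (sq_nonneg (y b)) zero_le_two).trans (hS b))
    rw [hb] at h₁
    have h₂ : M ^ 2 * (ξ ^ 2 * Δ) ≤ M ^ 2 * (32 / 3 * Δ ^ 4) := by linarith
    have h₃ := le_of_mul_le_mul_left h₂ (by positivity)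
    have h₄ : Δ * ξ ^ 2 ≤ Δ * (32 / 3 * Δ ^ 3) := by linarith
    have h₅ := le_of_mul_le_mul_left h₄ hΔpos
    linarith
  · have hv := ((hasDerivAt_pow 2 t).sub_const (ξ ^ 2)).div_const 4
    have hq := ((hasDerivAt_pow 2 t).div_const 4).const_sub N
    refine (((((hz t).pow 2).add (hq.mul ((hy t).pow 2))).const_mul (ξ ^ 2)).add
      (((hv.const_mul (ξ ^ 2)).sub
        ((hv.pow 3).const_mul (4 * Δ / 3))).const_mul (M ^ 2))).congr_deriv ?_
    simp
    ring
  · intro t ht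
    have h := hysq t ht
    exact mul_nonpos_of_nonneg_of_nonpos (by linarith [ht.1]) (by linarith)

theorem three_mul_le_of_max {y z : ℝ → ℝ} {N ξ : ℝ} (hy : ∀ x, HasDerivAt y (z x) x)
    (hz : ∀ x, HasDerivAt z ((x ^ 2 / 4 - N) * y x) x)
    (hS : ∀ x, y x ^ 2 / 2 ≤ z x ^ 2 + (N - x ^ 2 / 4) * y x ^ 2) (hξ : 0 ≤ ξ)
    (h₀ : y ξ ≠ 0) (hmax : ∀ x, y x ^ 2 ≤ y ξ ^ 2) (hzξ : z ξ = 0) :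
    3 * N ≤ 8 * (N - ξ ^ 2 / 4) ^ 3 + 3 * (N - ξ ^ 2 / 4) := by
  rcases h₀.lt_or_gt with h | h
  · refine three_mul_le_of_max_pos (y := fun x => -y x) (z := fun x => -z x)
      (fun x => (hy x).neg) (fun x => ?_) (fun x => ?_) hξ (neg_pos.2 h) (fun x => ?_) ?_
    · exact (hz x).neg.congr_deriv (by ring)
    · simpa using hS x
    · simpa using hmax x
    · simpa using hzξ
  · exact three_mul_le_of_max_pos hy hz hS hξ h hmax hzξ

/-- Monotonicity of the modified energy
`f (y'² + (N - x² / 4) y²) - f' y y' + f'' y² / 2` with `f = (A - x² / 4) ^ (-1 / 2)`. -/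
theorem energy_le {y z : ℝ → ℝ} {N A ξ : ℝ} (hy : ∀ x, HasDerivAt y (z x) x)
    (hz : ∀ x, HasDerivAt z ((x ^ 2 / 4 - N) * y x) x) (hξ : 0 ≤ ξ) (hNA : N ≤ A)
    (hP : 0 < A - ξ ^ 2 / 4)
    (hA : 15 / 16 * A ≤ (A - N) * (A - ξ ^ 2 / 4) ^ 2 + 6 / 16 * (A - ξ ^ 2 / 4))
    {s : ℝ → ℝ} (hs : s = fun x => (√(A - x ^ 2 / 4))⁻¹) (hzξ : z ξ = 0) :
    y ξ ^ 2 * (s ξ * (N - ξ ^ 2 / 4) + s ξ ^ 3 / 8 + 3 * ξ ^ 2 / 32 * s ξ ^ 5) ≤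
      s 0 * (z 0 ^ 2 + N * y 0 ^ 2) + s 0 ^ 3 / 8 * y 0 ^ 2 := by
  have hp : ∀ x ∈ Set.Icc 0 ξ, A - ξ ^ 2 / 4 ≤ A - x ^ 2 / 4 := by
    intro x hx
    have := pow_le_pow_left₀ hx.1 hx.2 2
    linarith
  have hsp : ∀ x ∈ Set.Icc 0 ξ, 0 < s x ∧ s x ^ 2 * (A - x ^ 2 / 4) = 1 := by
    intro x hx
    have h : 0 < A - x ^ 2 / 4 := hP.trans_le (hp x hx)
    rw [hs]
    refine ⟨by positivity, ?_⟩
    simp only [inv_pow, Real.sq_sqrt h.le]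
    exact inv_mul_cancel₀ h.ne'
  have hsd : ∀ x ∈ Set.Icc 0 ξ, HasDerivAt s (x / 4 * s x ^ 3) x := by
    intro x hx
    have h : 0 < A - x ^ 2 / 4 := hP.trans_le (hp x hx)
    have hd := ((((hasDerivAt_pow 2 x).div_const 4).const_sub A).sqrt h.ne').inv
      (Real.sqrt_ne_zero'.2 h)
    rw [hs]
    refine hd.congr_deriv ?_
    have : √(A - x ^ 2 / 4) ≠ 0 := Real.sqrt_ne_zero'.2 h
    simp
    field_simp
  have h := le_of_hasDerivAt_nonpos
    (f := fun x => s x * (z x ^ 2 + (N - x ^ 2 / 4) * y x ^ 2) - x / 4 * s x ^ 3 * (y x * z x) +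
      (s x ^ 3 / 8 + 3 / 32 * x ^ 2 * s x ^ 5) * y x ^ 2)
    (f' := fun x => y x ^ 2 * (x / 2) * (s x ^ 5 * (9 / 16) + 15 / 64 * x ^ 2 * s x ^ 7
      + (N - x ^ 2 / 4) * s x ^ 3 - s x)) hξ (fun x hx => ?_) ?_
  · simp only [hzξ] at h
    ring_nf at h ⊢
    linarith
  · have hq := ((hasDerivAt_pow 2 x).div_const 4).const_sub N
    have h₁ := hsd x hx
    refine (((h₁.mul (((hz x).pow 2).add (hq.mul ((hy x).pow 2)))).sub
      ((((hasDerivAt_id x).div_const 4).mul (h₁.pow 3)).mul ((hy x).mul (hz x)))).add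
      ((((h₁.pow 3).div_const 8).add (((hasDerivAt_pow 2 x).const_mul (3 / 32)).mul
        (h₁.pow 5))).mul ((hy x).pow 2))).congr_deriv ?_
    simp
    ring
  · intro x hx
    obtain ⟨h₁, h₂⟩ := hsp x hx
    refine mul_nonpos_of_nonneg_of_nonpos (mul_nonneg (sq_nonneg _) (by linarith [hx.1])) ?_
    set p := A - x ^ 2 / 4 with hp'
    have hpx : A - ξ ^ 2 / 4 ≤ p := hp x hx
    have hx2 : x ^ 2 = 4 * (A - p) := by rw [hp']; ring
    have h₃ : s x ^ 5 * (9 / 16) + 15 / 64 * x ^ 2 * s x ^ 7 + (N - x ^ 2 / 4) * s x ^ 3 - s x =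
        s x ^ 7 * (15 / 16 * A - 6 / 16 * p - (A - N) * p ^ 2) := by
      rw [show N - x ^ 2 / 4 = p - (A - N) by rw [hp']; ring, hx2]
      linear_combination
        (s x + (A - N) * s x ^ 3 * (1 + s x ^ 2 * p) - 9 / 16 * s x ^ 5) * h₂
    rw [h₃]
    refine mul_nonpos_of_nonneg_of_nonpos (by positivity) ?_
    have h₄ := mul_le_mul_of_nonneg_left (pow_le_pow_left₀ hP.le hpx 2) (sub_nonneg.2 hNA)
    linarith

theorem hermiteDeriv_apply_zero (n : ℕ) : hermiteDeriv n 0 = -H (n + 1) 0 := by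
  rw [H_succ]
  ring

theorem H_odd_zero (m : ℕ) : H (2 * m + 1) 0 = 0 := by
  have h := H_neg (2 * m + 1) 0
  rw [neg_zero, pow_succ, pow_mul] at h
  norm_num at h
  linarith

theorem H_even_zero_bound (m : ℕ) :
    (H (2 * m) 0 ^ 2) ^ 2 * (3 * m + 1) ≤ ((2 * m).factorial : ℝ) ^ 2 := by
  induction m with
  | zero => simp [H_zero]
  | succ m ih =>
    rw [show 2 * (m + 1) = 2 * m + 2 by ring, H_add_two, Nat.factorial_succ, Nat.factorial_succ]
    push_cast
    set e := H (2 * m) 0 ^ 2 with he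
    have h₁ : ((0 * H (2 * m + 1) 0 - (2 * m + 1) * H (2 * m) 0) ^ 2) ^ 2 =
        (2 * (m : ℝ) + 1) ^ 4 * e ^ 2 := by rw [he]; ring
    rw [h₁]
    have h₂ : (2 * (m : ℝ) + 1) ^ 2 * (3 * (m + 1) + 1) ≤ (2 * m + 2) ^ 2 * (3 * m + 1) := by
      nlinarith [Nat.cast_nonneg (α := ℝ) m]
    have h₃ := mul_le_mul_of_nonneg_left h₂
      (mul_nonneg (sq_nonneg (2 * (m : ℝ) + 1)) (sq_nonneg e))
    have h₄ := mul_le_mul_of_nonneg_left ih (sq_nonneg ((2 * (m : ℝ) + 2) * (2 * m + 1)))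
    linarith

/-- A bound for the modified energy of the Hermite function at the origin. -/
theorem energy_zero_le {n : ℕ} (hn : n ≠ 0) {s : ℝ} (hs : s ^ 2 * (n + 1 / 2) ≤ 1) :
    s * (hermiteFunDeriv n 0 ^ 2 + (n + 1 / 2) * hermiteFun n 0 ^ 2) +
      s ^ 3 / 8 * hermiteFun n 0 ^ 2 ≤ 0.8165 * n.factorial := by
  have hw := sq_nonneg s
  refine le_of_sq_le_sq ?_ (by positivity)
  have hy : hermiteFun n 0 = H n 0 := by simp [hermiteFun]
  have hz : hermiteFunDeriv n 0 = -H (n + 1) 0 := by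
    simp [hermiteFunDeriv, hermiteDeriv_apply_zero]
  rw [hy, hz]
  obtain ⟨m, rfl | rfl⟩ := Nat.even_or_odd' n
  · have hb := H_even_zero_bound m
    have hm : (1 : ℝ) ≤ m := by exact_mod_cast Nat.pos_of_ne_zero (by rintro rfl; simp at hn)
    rw [H_odd_zero]
    push_cast at hs ⊢
    set e := H (2 * m) 0 ^ 2
    set w := s ^ 2 with hwdef
    have h₁ : w * (2 * m + 1 / 2 + w / 8) ^ 2 ≤ 2 / 3 * (3 * m + 1) := by
      have hw1 : w ≤ 2 / 5 := by nlinarith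
      have h₂ : w * (2 * m + 1 / 2) * (2 * m + 1 / 2) ≤ 1 * (2 * m + 1 / 2) := by gcongr
      have h₃ : w * (w * (2 * m + 1 / 2)) ≤ 2 / 5 * 1 := by gcongr
      have h₄ : w * (w * w) ≤ 2 / 5 * (2 / 5 * (2 / 5)) := by gcongr
      nlinarith
    have h₅ := mul_le_mul_of_nonneg_left h₁ (sq_nonneg e)
    have h₆ : (s * ((-0) ^ 2 + (2 * m + 1 / 2) * e) + s ^ 3 / 8 * e) ^ 2 =
      e ^ 2 * (w * (2 * m + 1 / 2 + w / 8) ^ 2) := by rw [hwdef]; ring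
    rw [h₆]
    nlinarith [sq_nonneg ((2 * m).factorial : ℝ)]
  · have hb := H_even_zero_bound m
    rw [H_odd_zero, H_add_two, H_odd_zero, Nat.factorial_succ]
    push_cast at hs ⊢
    have hm : (0 : ℝ) ≤ m := m.cast_nonneg
    set e := H (2 * m) 0 ^ 2 with he
    set w := s ^ 2 with hwdef
    have h₁ : w * (2 * m + 1) ^ 2 ≤ 2 / 3 * (3 * m + 1) := by
      have h₂ : w * (2 * m + 1 + 1 / 2) * (2 * m + 2 / 3) ≤ 1 * (2 * m + 2 / 3) := by gcongr
      nlinarith [mul_nonneg hw hm]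
    have h₅ := mul_le_mul_of_nonneg_left h₁
      (mul_nonneg (sq_nonneg (2 * (m : ℝ) + 1)) (sq_nonneg e))
    have h₆ : (s * ((-(0 * 0 - (2 * m + 1) * H (2 * m) 0)) ^ 2 + (2 * m + 1 + 1 / 2) * 0 ^ 2) +
      s ^ 3 / 8 * 0 ^ 2) ^ 2 = (2 * (m : ℝ) + 1) ^ 2 * e ^ 2 * (w * (2 * m + 1) ^ 2) := by
      rw [hwdef, he]; ring
    rw [h₆]
    have h₇ := mul_le_mul_of_nonneg_left hb (sq_nonneg (2 * (m : ℝ) + 1))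
    nlinarith [sq_nonneg ((2 * (m : ℝ) + 1) * (2 * m).factorial)]

theorem mul_le_of_three_mul_cube_le {r Δ : ℝ} (hr : 1.144 ≤ r)
    (h : 3 * r ^ 3 ≤ 8 * Δ ^ 3 + 3 * Δ) : 0.58 * r ≤ Δ := by
  by_contra! hlt
  have h₁ : Δ ^ 3 ≤ (0.58 * r) ^ 3 := (Odd.strictMono_pow (by decide : Odd 3)).monotone hlt.le
  have h₂ : 1.144 ^ 2 * r ≤ r ^ 2 * r := by gcongr
  nlinarith

/-- A lower bound for the coefficient of `y²` in the modified energy at a critical point, where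
`N = r ^ 3`, the distance to the turning point is measured by `Δ`, and `s ^ 2 = (Δ + 0.7 r)⁻¹`. -/
theorem energy_coeff_ge {r Δ s : ℝ} (hr : 1.144 ≤ r) (hΔ : 0.58 * r ≤ Δ) (hs₀ : 0 ≤ s)
    (hs : s ^ 2 * (Δ + 0.7 * r) = 1) :
    0.692 ≤ s * Δ + s ^ 3 / 8 + 3 * (4 * (r ^ 3 - Δ)) / 32 * s ^ 5 := by
  have hr₀ : 0 < r := by linarith
  obtain ⟨p, hp⟩ : ∃ p, Δ = r * p - 0.7 * r := ⟨(Δ + 0.7 * r) / r, by field_simp; ring⟩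
  subst hp
  have hp : 1.28 ≤ p := by nlinarith
  have hp₀ : 0 < p := by linarith
  have hw : s ^ 2 = 1 / (r * p) := by
    rw [eq_div_iff (by positivity)]
    linarith
  have hq : 1 / r ^ 2 ≤ 0.7642 := by
    rw [div_le_iff₀ (by positivity)]
    nlinarith
  have hB : 0.286 * p + 0.3665 ≤
      (p ^ 3 - 0.7 * p ^ 2 - (0.25 * p - 0.2625) * (1 / r ^ 2) + 0.375) / p ^ 2 := by
    rw [le_div_iff₀ (by positivity)]
    have h₁ := mul_le_mul_of_nonneg_left hq (show 0 ≤ 0.25 * p - 0.2625 by linarith)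
    nlinarith [sq_nonneg (p - 1.28), mul_nonneg (sq_nonneg (p - 1.28)) hp₀.le]
  have hsum : s * (r * p - 0.7 * r) + s ^ 3 / 8 +
      3 * (4 * (r ^ 3 - (r * p - 0.7 * r))) / 32 * s ^ 5 = s * (r *
      ((p ^ 3 - 0.7 * p ^ 2 - (0.25 * p - 0.2625) * (1 / r ^ 2) + 0.375) / p ^ 2)) := by
    rw [show s ^ 3 = s * s ^ 2 by ring, show s ^ 5 = s * (s ^ 2) ^ 2 by ring, hw]
    field_simp
    ring
  rw [hsum]
  refine le_trans ?_ (mul_le_mul_of_nonneg_left (mul_le_mul_of_nonneg_left hB hr₀.le) hs₀)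
  refine le_of_sq_le_sq ?_ (by positivity)
  rw [mul_pow, hw, mul_pow, div_mul_eq_mul_div, le_div_iff₀ (by positivity)]
  have h₃ : 0.419 * p ≤ (0.286 * p + 0.3665) ^ 2 := by
    nlinarith [sq_nonneg (0.286 * p - 0.3665)]
  have h₄ : r * (1.144 * (0.419 * p)) ≤ r * (r * (0.286 * p + 0.3665) ^ 2) := by gcongr
  nlinarith [mul_pos hr₀ hp₀]

theorem sq_hermiteFun_le_of_max {n : ℕ} (hn : n ≠ 0) {ξ : ℝ} (hξ : 0 ≤ ξ)
    (h₀ : hermiteFun n ξ ≠ 0) (hmax : ∀ t, hermiteFun n t ^ 2 ≤ hermiteFun n ξ ^ 2) :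
    hermiteFun n ξ ^ 2 ≤ 1.087 ^ 2 * n.factorial := by
  have hzξ := hermiteFunDeriv_eq_zero_of_max h₀ hmax
  have hn1 : (1 : ℝ) ≤ n := by exact_mod_cast Nat.pos_of_ne_zero hn
  obtain ⟨r, hr₀, hrN⟩ : ∃ r : ℝ, 0 ≤ r ∧ r ^ 3 = n + 1 / 2 :=
    ⟨((n : ℝ) + 1 / 2) ^ ((3 : ℕ) : ℝ)⁻¹, by positivity,
      Real.rpow_inv_natCast_pow (by positivity) (by norm_num)⟩
  have hr : 1.144 ≤ r := by
    refine le_of_pow_le_pow_left₀ three_ne_zero hr₀ ?_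
    rw [hrN]
    linarith
  have hdist := three_mul_le_of_max (hasDerivAt_hermiteFun n) (hasDerivAt_hermiteFunDeriv n)
    (half_sq_hermiteFun_le n) hξ h₀ hmax hzξ
  obtain ⟨Δ, hΔdef⟩ : ∃ Δ : ℝ, Δ = n + 1 / 2 - ξ ^ 2 / 4 := ⟨_, rfl⟩
  rw [← hΔdef, ← hrN] at hdist
  have hΔ := mul_le_of_three_mul_cube_le hr hdist
  have hP : (n : ℝ) + 1 / 2 + 0.7 * r - ξ ^ 2 / 4 = Δ + 0.7 * r := by rw [hΔdef]; ring
  have hPpos : 0 < Δ + 0.7 * r := by linarith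
  have hE := energy_le (N := n + 1 / 2) (A := n + 1 / 2 + 0.7 * r) (hasDerivAt_hermiteFun n)
    (hasDerivAt_hermiteFunDeriv n) hξ (by linarith) (by rwa [hP]) ?_ rfl hzξ
  · have hsξ := energy_coeff_ge (s := (√(Δ + 0.7 * r))⁻¹) hr hΔ (by positivity) (by
      rw [inv_pow, Real.sq_sqrt hPpos.le, inv_mul_cancel₀ hPpos.ne'])
    have hs0 := energy_zero_le hn (s := (√((n : ℝ) + 1 / 2 + 0.7 * r - 0 ^ 2 / 4))⁻¹) (by
      have hA : (0 : ℝ) < n + 1 / 2 + 0.7 * r - 0 ^ 2 / 4 := by norm_num; positivity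
      rw [inv_pow, Real.sq_sqrt hA.le, inv_mul_le_iff₀ hA]
      linarith)
    have hE' := hE.trans hs0
    simp only [hP, ← hΔdef] at hE'
    rw [show ξ ^ 2 = 4 * (r ^ 3 - Δ) by rw [hrN, hΔdef]; ring] at hE'
    have h₁ := (mul_le_mul_of_nonneg_left hsξ (sq_nonneg (hermiteFun n ξ))).trans hE'
    have h₂ : (0 : ℝ) ≤ n.factorial := by positivity
    linarith
  · rw [hP, ← hrN]
    have h₁ : (1.28 * r) ^ 2 ≤ (Δ + 0.7 * r) ^ 2 := by gcongr; linarith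
    have h₂ := mul_le_mul_of_nonneg_left h₁ (show 0 ≤ 0.7 * r by positivity)
    have h₃ : 1.144 ^ 2 * r ≤ r ^ 2 * r := by gcongr
    nlinarith

theorem sq_hermiteFun_le (n : ℕ) (x : ℝ) :
    hermiteFun n x ^ 2 ≤ 1.087 ^ 2 * n.factorial := by
  by_cases hx : hermiteFun n x = 0
  · rw [hx, zero_pow two_ne_zero]
    positivity
  rcases eq_or_ne n 0 with rfl | hn
  · rw [sq_hermiteFun, H_zero, Nat.factorial_zero]
    have h : (1 : ℝ) ^ 2 / Real.exp (x ^ 2 / 2) ≤ 1 := by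
      rw [one_pow, div_le_one (Real.exp_pos _)]
      exact Real.one_le_exp (by positivity)
    exact h.trans (by norm_num)
  · obtain ⟨ξ, hξ, hmax⟩ := exists_nonneg_max_hermiteFun n hx
    have h₀ : hermiteFun n ξ ≠ 0 := fun h => by
      have h₁ := hmax x
      rw [h, zero_pow two_ne_zero] at h₁
      exact absurd h₁ (not_le.2 (sq_pos_of_ne_zero hx))
    exact (hmax x).trans (sq_hermiteFun_le_of_max hn hξ h₀ hmax)

theorem stmt_5 (n : ℕ) (x : ℝ) :
    H n x ^ 2 ≤ (1.087 : ℝ) ^ 2 * (n.factorial : ℝ) * Real.exp (x ^ 2 / 2) := by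
  have h := sq_hermiteFun_le n x
  rwa [sq_hermiteFun, div_le_iff₀ (Real.exp_pos _)] at h
end

section
/- Let ℓ > 0 and α > 0. For all real x and y, the Mercer series of the Gaussian kernel converges absolutely and ∑_{n=0}^{∞} λ_n·φ_n(x)·φ_n(y) = exp(−(x−y)²/(2ℓ²)). -/
open Polynomial MeasureTheory

/-- Polynomials `p n` with `p (n + 1) = X * p n + c * derivative (p n)`. The value `c = -1` gives
the Hermite polynomials. -/
noncomputable def hermiteScaled (c : ℤ) : ℕ → ℤ[X]
  | 0 => 1
  | n + 1 => X * hermiteScaled c n + C c * derivative (hermiteScaled c n)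

theorem hermiteScaled_neg_one (n : ℕ) : hermiteScaled (-1) n = hermite n := by
  induction n with
  | zero => simp [hermiteScaled]
  | succ n ih => rw [hermiteScaled, hermite_succ, ih]; simp [sub_eq_add_neg]

theorem derivative_hermiteScaled_succ (c : ℤ) (n : ℕ) :
    derivative (hermiteScaled c (n + 1)) = (n + 1 : ℤ[X]) * hermiteScaled c n := by
  induction n with
  | zero => simp [hermiteScaled]
  | succ n ih =>
    rw [hermiteScaled, derivative_add, derivative_mul, derivative_C_mul, ih]
    have h : derivative (n + 1 : ℤ[X]) = 0 := by exact_mod_cast derivative_natCast (n := n + 1)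
    simp only [derivative_mul, derivative_X, h]
    rw [hermiteScaled]
    push_cast
    ring

theorem hermiteScaled_add_two (c : ℤ) (n : ℕ) :
    hermiteScaled c (n + 2) =
      X * hermiteScaled c (n + 1) + C c * ((n + 1 : ℤ[X]) * hermiteScaled c n) := by
  rw [hermiteScaled, derivative_hermiteScaled_succ]

theorem abs_aeval_hermite_le (n : ℕ) (u : ℝ) :
    |aeval u (hermite n)| ≤ aeval |u| (hermiteScaled 1 n) := by
  rw [← hermiteScaled_neg_one]
  induction n using Nat.twoStepInduction with
  | zero => simp [hermiteScaled]
  | one => simp [hermiteScaled]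
  | more n h₀ h₁ =>
    simp only [hermiteScaled_add_two, map_add, map_mul, aeval_X, map_natCast, map_one, map_neg,
      neg_mul, one_mul]
    refine (abs_add_le _ _).trans ?_
    rw [abs_neg, abs_mul, abs_mul, abs_of_nonneg (by positivity : (0 : ℝ) ≤ n + 1)]
    gcongr

/-- The exponential generating function of `hermiteScaled c`. -/
theorem hasSum_hermiteScaled (c : ℤ) (u : ℝ) (t : ℂ) :
    HasSum (fun n : ℕ => ((aeval u (hermiteScaled c n) : ℝ) : ℂ) * t ^ n / n.factorial)
      (Complex.exp (u * t + c * t ^ 2 / 2)) := by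
  set f : ℂ → ℂ := fun t => Complex.exp (u * t + c * t ^ 2 / 2) with hf
  have key (n : ℕ) : iteratedDeriv n f = fun t : ℂ => aeval (u + c * t) (hermiteScaled c n) * f t := by
    induction n with
    | zero => simp [hermiteScaled]
    | succ n ih =>
      rw [iteratedDeriv_succ, ih]
      ext t
      have h₁ : HasDerivAt (fun t : ℂ => u + c * t) (c : ℂ) t := by
        simpa using ((hasDerivAt_id t).const_mul (c : ℂ)).const_add (u : ℂ)
      have h₂ : HasDerivAt f (f t * (u + c * t)) t := by
        have h : HasDerivAt (fun t : ℂ => u * t + c * t ^ 2 / 2) (u + c * t) t := by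
          refine (((hasDerivAt_id' t).const_mul (u : ℂ)).fun_add
            ((((hasDerivAt_id' t).fun_pow 2).const_mul (c : ℂ)).div_const 2)).congr_deriv ?_
          simp
          ring
        exact h.cexp
      have h₃ := (((hermiteScaled c n).hasDerivAt_aeval (u + c * t)).comp t h₁).mul h₂
      refine h₃.deriv.trans ?_
      simp [hermiteScaled]
      ring
  have h := Complex.hasSum_taylorSeries_of_entire (f := f) (by fun_prop) 0 t
  refine h.congr_fun fun k => ?_
  have := aeval_algebraMap_apply ℂ u (hermiteScaled c k)
  simp only [Complex.coe_algebraMap] at this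
  rw [key]
  simp [hf, this]
  ring

theorem norm_add_mul_I_sq (v z : ℝ) : ‖(v + z * Complex.I : ℂ)‖ ^ 2 = v ^ 2 + z ^ 2 := by
  rw [Complex.sq_norm, Complex.normSq_add_mul_I]

theorem integrable_exp_norm_add_mul_I (v c q : ℝ) (hq : q < 1) :
    Integrable fun z : ℝ => Real.exp (c * ‖(v + z * Complex.I : ℂ)‖ +
      q * ‖(v + z * Complex.I : ℂ)‖ ^ 2 / 2) * Real.exp (-z ^ 2 / 2) := by
  have hq' : 0 < 1 - q := by linarith
  have h : Integrable fun z : ℝ => Real.exp (c ^ 2 / (1 - q) + (1 + q) / 4 * v ^ 2) *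
      Real.exp (-((1 - q) / 4) * z ^ 2) :=
    (integrable_exp_neg_mul_sq (by linarith)).const_mul _
  refine h.mono' (by fun_prop) (.of_forall fun z => ?_)
  rw [Real.norm_of_nonneg (by positivity), ← Real.exp_add, ← Real.exp_add, Real.exp_le_exp]
  have h₁ := norm_add_mul_I_sq v z
  set r := ‖(v + z * Complex.I : ℂ)‖
  have h₂ : c * r ≤ c ^ 2 / (1 - q) + (1 - q) / 4 * r ^ 2 := by
    have : c ^ 2 / (1 - q) + (1 - q) / 4 * r ^ 2 - c * r =
        (c - (1 - q) / 2 * r) ^ 2 / (1 - q) := by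
      field_simp
      ring
    have : 0 ≤ (c - (1 - q) / 2 * r) ^ 2 / (1 - q) := by positivity
    linarith
  rw [h₁] at h₂ ⊢
  linarith

theorem integrable_pow_mul_gaussian (v : ℝ) (n : ℕ) :
    Integrable fun z : ℝ => (v + z * Complex.I : ℂ) ^ n * Real.exp (-z ^ 2 / 2) := by
  refine ((integrable_exp_norm_add_mul_I v 1 0 one_pos).const_mul (n.factorial : ℝ)).mono'
    (by fun_prop) (.of_forall fun z => ?_)
  rw [norm_mul, norm_pow, Complex.norm_real, Real.norm_of_nonneg (Real.exp_pos _).le, ← mul_assoc]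
  gcongr
  have := Real.pow_div_factorial_le_exp ‖(v + z * Complex.I : ℂ)‖ (norm_nonneg _) n
  rw [div_le_iff₀ (by positivity)] at this
  simpa [mul_comm] using this

theorem integral_pow_succ_mul_gaussian (v : ℝ) (n : ℕ) :
    ∫ z : ℝ, (v + z * Complex.I : ℂ) ^ (n + 1) * Real.exp (-z ^ 2 / 2) =
      v * (∫ z : ℝ, (v + z * Complex.I : ℂ) ^ n * Real.exp (-z ^ 2 / 2)) -
      n * ∫ z : ℝ, (v + z * Complex.I : ℂ) ^ (n - 1) * Real.exp (-z ^ 2 / 2) := by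
  have h₀ := (integrable_pow_mul_gaussian v (n - 1)).const_mul (n : ℂ)
  have h₁ := (integrable_pow_mul_gaussian v n).const_mul (v : ℂ)
  have h₂ := integrable_pow_mul_gaussian v (n + 1)
  have hd (z : ℝ) : HasDerivAt
      (fun z : ℝ => Complex.I * ((v + z * Complex.I : ℂ) ^ n * Real.exp (-z ^ 2 / 2)))
      (v * ((v + z * Complex.I : ℂ) ^ n * Real.exp (-z ^ 2 / 2)) -
        (n * ((v + z * Complex.I : ℂ) ^ (n - 1) * Real.exp (-z ^ 2 / 2)) +
        (v + z * Complex.I : ℂ) ^ (n + 1) * Real.exp (-z ^ 2 / 2))) z := by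
    have hw : HasDerivAt (fun z : ℝ => (v + z * Complex.I : ℂ)) Complex.I z := by
      simpa using ((Complex.ofRealCLM.hasDerivAt (x := z)).mul_const Complex.I).const_add (v : ℂ)
    have he : HasDerivAt (fun z : ℝ => ((Real.exp (-z ^ 2 / 2) : ℝ) : ℂ))
        ((Real.exp (-z ^ 2 / 2) * -z : ℝ) : ℂ) z := by
      have h : HasDerivAt (fun z : ℝ => -z ^ 2 / 2) (-z) z := by
        refine (((hasDerivAt_id' z).fun_pow 2).fun_neg.div_const 2).congr_deriv ?_
        simp
        ring
      exact h.exp.ofReal_comp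
    refine (((hw.fun_pow n).fun_mul he).const_mul Complex.I).congr_deriv ?_
    push_cast
    linear_combination ((n : ℂ) * (v + z * Complex.I : ℂ) ^ (n - 1) * Complex.exp (-z ^ 2 / 2)) *
      Complex.I_sq
  have h := integral_eq_zero_of_hasDerivAt_of_integrable hd (h₁.sub (h₀.add h₂))
    ((integrable_pow_mul_gaussian v n).const_mul _)
  rw [integral_sub h₁ (by exact h₀.add h₂), integral_add h₀ h₂, integral_const_mul, integral_const_mul] at h
  linear_combination -h

theorem integral_gaussian_half : ∫ z : ℝ, Real.exp (-z ^ 2 / 2) = √(2 * Real.pi) := by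
  have := integral_gaussian (1 / 2)
  rw [div_div_eq_mul_div, div_one, mul_comm] at this
  rw [← this]
  congr 1 with z
  congr 1
  ring

/-- Hermite polynomials as Gaussian averages of the monomials `(v + i z) ^ n`. -/
theorem integral_pow_mul_gaussian (v : ℝ) (n : ℕ) :
    ∫ z : ℝ, (v + z * Complex.I : ℂ) ^ n * Real.exp (-z ^ 2 / 2) =
      ((√(2 * Real.pi) * aeval v (hermite n) : ℝ) : ℂ) := by
  rw [← hermiteScaled_neg_one]
  induction n using Nat.twoStepInduction with
  | zero =>
    simp only [pow_zero, one_mul, hermiteScaled, map_one, mul_one]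
    rw [integral_complex_ofReal, integral_gaussian_half]
  | one =>
    have h := integral_pow_succ_mul_gaussian v 0
    simp only [zero_add, pow_zero, one_mul, Nat.cast_zero, zero_mul, sub_zero] at h
    rw [h, integral_complex_ofReal, integral_gaussian_half]
    simp [hermiteScaled, mul_comm]
  | more n h₀ h₁ =>
    rw [integral_pow_succ_mul_gaussian, Nat.add_sub_cancel, h₀, h₁]
    simp [hermiteScaled_add_two]
    ring

theorem integral_mehler (ρ u v : ℝ) (hρ : |ρ| < 1) :
    ∫ z : ℝ, Complex.exp (u * (ρ * (v + z * Complex.I)) +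
        ((-1 : ℤ) : ℂ) * (ρ * (v + z * Complex.I)) ^ 2 / 2) * Real.exp (-z ^ 2 / 2) =
      ((√(2 * Real.pi) * (√(1 - ρ ^ 2))⁻¹ *
        Real.exp (-(ρ ^ 2 * (u ^ 2 + v ^ 2) - 2 * ρ * u * v) / (2 * (1 - ρ ^ 2))) : ℝ) : ℂ) := by
  have hρ' : 0 < 1 - ρ ^ 2 := by
    have := (sq_lt_one_iff_abs_lt_one ρ).2 hρ
    linarith
  have hb : (((-((1 - ρ ^ 2) / 2) : ℝ) : ℂ)).re < 0 := by
    rw [Complex.ofReal_re]; linarith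
  have h := integral_cexp_quadratic hb ((ρ * u - ρ ^ 2 * v) * Complex.I)
    (ρ * u * v - ρ ^ 2 * v ^ 2 / 2)
  have hpre : ((Real.pi : ℂ) / -((-((1 - ρ ^ 2) / 2) : ℝ) : ℂ)) ^ (1 / 2 : ℂ) =
      ((√(2 * Real.pi) * (√(1 - ρ ^ 2))⁻¹ : ℝ) : ℂ) := by
    rw [← div_eq_mul_inv, ← Real.sqrt_div (by positivity), Real.sqrt_eq_rpow,
      Complex.ofReal_cpow (by positivity)]
    congr 1
    · push_cast
      rw [neg_neg, div_div_eq_mul_div, mul_comm]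
    · simp
  rw [hpre] at h
  have hne : (1 - ρ ^ 2 : ℂ) ≠ 0 := by exact_mod_cast hρ'.ne'
  rw [Complex.ofReal_mul, Complex.ofReal_exp]
  convert h using 2
  · ext z
    rw [Complex.ofReal_exp, ← Complex.exp_add]
    congr 1
    push_cast
    linear_combination (-ρ ^ 2 * z ^ 2 / 2 : ℂ) * Complex.I_sq
  · congr 1
    push_cast
    rw [mul_pow, Complex.I_sq]
    field_simp
    ring

/-- Mehler's formula for the probabilists' Hermite polynomials. -/
theorem hasSum_mehler (ρ u v : ℝ) (hρ : |ρ| < 1) :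
    HasSum (fun n : ℕ => ρ ^ n / n.factorial * H n u * H n v)
      ((√(1 - ρ ^ 2))⁻¹ *
        Real.exp (-(ρ ^ 2 * (u ^ 2 + v ^ 2) - 2 * ρ * u * v) / (2 * (1 - ρ ^ 2)))) := by
  have hb (z : ℝ) : HasSum (fun n : ℕ => aeval |u| (hermiteScaled 1 n) *
      (|ρ| * ‖(v + z * Complex.I : ℂ)‖) ^ n / n.factorial * Real.exp (-z ^ 2 / 2))
      (Real.exp (|u| * |ρ| * ‖(v + z * Complex.I : ℂ)‖ +
        ρ ^ 2 * ‖(v + z * Complex.I : ℂ)‖ ^ 2 / 2) * Real.exp (-z ^ 2 / 2)) := by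
    refine HasSum.mul_right _ ?_
    have h := hasSum_hermiteScaled 1 |u| ((|ρ| * ‖(v + z * Complex.I : ℂ)‖ : ℝ) : ℂ)
    rw [← Complex.hasSum_ofReal]
    convert h using 1
    · push_cast
      rfl
    · rw [← sq_abs ρ]
      push_cast
      congr 1
      ring
  have h := hasSum_integral_of_dominated_convergence (μ := volume)
    (F := fun (n : ℕ) (z : ℝ) => ((aeval u (hermiteScaled (-1) n) : ℝ) : ℂ) *
      (ρ * (v + z * Complex.I)) ^ n / n.factorial * Real.exp (-z ^ 2 / 2))
    (fun n z => aeval |u| (hermiteScaled 1 n) *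
      (|ρ| * ‖(v + z * Complex.I : ℂ)‖) ^ n / n.factorial * Real.exp (-z ^ 2 / 2))
    (fun n => by fun_prop)
    (fun n => .of_forall fun z => by
      rw [norm_mul, norm_div, norm_mul, norm_pow, norm_mul, Complex.norm_real, Complex.norm_real,
        Complex.norm_real, Complex.norm_natCast, Real.norm_of_nonneg (Real.exp_pos _).le,
        Real.norm_eq_abs, Real.norm_eq_abs, hermiteScaled_neg_one]
      gcongr
      exact abs_aeval_hermite_le n u)
    (.of_forall fun z => (hb z).summable)
    (by
      simp_rw [fun z => (hb z).tsum_eq]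
      exact integrable_exp_norm_add_mul_I v _ _ ((sq_lt_one_iff_abs_lt_one ρ).2 hρ))
    (.of_forall fun z =>
      (hasSum_hermiteScaled (-1) u (ρ * (v + z * Complex.I))).mul_right _)
  rw [integral_mehler ρ u v hρ] at h
  have hpi : √(2 * Real.pi) ≠ 0 := by positivity
  have hF (n : ℕ) : ∫ z : ℝ, ((aeval u (hermiteScaled (-1) n) : ℝ) : ℂ) *
      (ρ * (v + z * Complex.I)) ^ n / n.factorial * Real.exp (-z ^ 2 / 2) =
      ((√(2 * Real.pi) * (ρ ^ n / n.factorial * H n u * H n v) : ℝ) : ℂ) := by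
    have (z : ℝ) : ((aeval u (hermiteScaled (-1) n) : ℝ) : ℂ) *
        (ρ * (v + z * Complex.I)) ^ n / n.factorial * Real.exp (-z ^ 2 / 2) =
        ((aeval u (hermite n) : ℝ) : ℂ) * ρ ^ n / n.factorial *
          ((v + z * Complex.I) ^ n * Real.exp (-z ^ 2 / 2)) := by
      rw [hermiteScaled_neg_one, mul_pow]
      ring
    simp_rw [this]
    rw [integral_const_mul, integral_pow_mul_gaussian]
    simp only [H]
    push_cast
    ring
  simp_rw [hF] at h
  rw [Complex.hasSum_ofReal, mul_assoc] at h
  exact (hasSum_mul_left_iff hpi).1 h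

theorem stmt_11 (ℓ α : ℝ) (hℓ : 0 < ℓ) (hα : 0 < α)
    (ε β δ2 : ℝ)
    (hε : ε = 1 / (Real.sqrt 2 * ℓ))
    (hβ : β = (1 + (2 * ε / α) ^ 2) ^ ((1 : ℝ) / 4))
    (hδ2 : δ2 = α ^ 2 * (β ^ 2 - 1) / 2)
    (φ : ℕ → ℝ → ℝ)
    (hφ : ∀ n x, φ n x = Real.sqrt (β / (n.factorial : ℝ)) * Real.exp (-δ2 * x ^ 2) *
      H n (Real.sqrt 2 * α * β * x))
    (lam : ℕ → ℝ)
    (hlam : ∀ n, lam n = Real.sqrt (α ^ 2 / (α ^ 2 + δ2 + ε ^ 2)) *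
      (ε ^ 2 / (α ^ 2 + δ2 + ε ^ 2)) ^ n)
    (x y : ℝ) :
    (Summable fun n : ℕ => |lam n * φ n x * φ n y|) ∧
    ∑' n : ℕ, lam n * φ n x * φ n y = Real.exp (-(x - y) ^ 2 / (2 * ℓ ^ 2)) := by
  have hS : HasSum (fun n : ℕ => lam n * φ n x * φ n y)
      (Real.exp (-(x - y) ^ 2 / (2 * ℓ ^ 2))) := by
    have hε2 : ε ^ 2 = 1 / (2 * ℓ ^ 2) := by
      rw [hε, div_pow, mul_pow, Real.sq_sqrt zero_le_two, one_pow]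
    have hε0 : 0 < ε ^ 2 := by rw [hε2]; positivity
    have hβ0 : 0 < β := by rw [hβ]; positivity
    have hβ4 : β ^ 4 = 1 + 4 * ε ^ 2 / α ^ 2 := by
      rw [hβ, ← Real.rpow_natCast, ← Real.rpow_mul (by positivity)]
      norm_num
      ring
    have hεβ : ε ^ 2 = α ^ 2 * (β ^ 4 - 1) / 4 := by
      rw [hβ4]
      field_simp
      ring
    have hβ1 : 1 < β ^ 2 := by
      have : 1 < β ^ 4 := by
        rw [hβ4]
        have : 0 < 4 * ε ^ 2 / α ^ 2 := by positivity
        linarith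
      nlinarith [sq_nonneg β]
    have hsum : α ^ 2 + δ2 + ε ^ 2 = α ^ 2 * (β ^ 2 + 1) ^ 2 / 4 := by
      rw [hεβ, hδ2]
      ring
    have hρ : ε ^ 2 / (α ^ 2 + δ2 + ε ^ 2) = (β ^ 2 - 1) / (β ^ 2 + 1) := by
      rw [hsum, hεβ]
      field_simp
      ring
    have hpre : √(α ^ 2 / (α ^ 2 + δ2 + ε ^ 2)) = 2 / (β ^ 2 + 1) := by
      rw [hsum, Real.sqrt_eq_iff_mul_self_eq (by positivity) (by positivity)]
      field_simp
      norm_num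
    set ρ := (β ^ 2 - 1) / (β ^ 2 + 1) with hρ_def
    have hρ1 : |ρ| < 1 := by
      rw [abs_of_nonneg (div_nonneg (by linarith) (by positivity)), hρ_def,
        div_lt_one (by positivity)]
      linarith
    have hρ2 : 1 - ρ ^ 2 = (2 * β / (β ^ 2 + 1)) ^ 2 := by
      rw [hρ_def]
      field_simp
      ring
    have h2 : √2 ^ 2 = 2 := Real.sq_sqrt zero_le_two
    have h := (hasSum_mehler ρ (√2 * α * β * x) (√2 * α * β * y) hρ1).mul_left
      (2 * β / (β ^ 2 + 1) * (Real.exp (-δ2 * x ^ 2) * Real.exp (-δ2 * y ^ 2)))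
    have hval : 2 * β / (β ^ 2 + 1) * (Real.exp (-δ2 * x ^ 2) * Real.exp (-δ2 * y ^ 2)) *
        ((√(1 - ρ ^ 2))⁻¹ * Real.exp (-(ρ ^ 2 * ((√2 * α * β * x) ^ 2 + (√2 * α * β * y) ^ 2) -
          2 * ρ * (√2 * α * β * x) * (√2 * α * β * y)) / (2 * (1 - ρ ^ 2)))) =
        Real.exp (-(x - y) ^ 2 / (2 * ℓ ^ 2)) := by
      rw [hρ2, Real.sqrt_sq (by positivity), mul_mul_mul_comm, mul_inv_cancel₀ (by positivity),
        one_mul, ← Real.exp_add, ← Real.exp_add]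
      congr 1
      have hx : -(x - y) ^ 2 / (2 * ℓ ^ 2) = -(x - y) ^ 2 * ε ^ 2 := by rw [hε2]; ring
      have hxy : √2 * α * β * x * (√2 * α * β * y) = 2 * α ^ 2 * β ^ 2 * x * y := by
        linear_combination α ^ 2 * β ^ 2 * x * y * h2
      rw [mul_assoc _ (√2 * α * β * x), hxy]
      simp only [mul_pow, h2]
      rw [hx, hεβ, hδ2, hρ_def]
      field_simp
      ring
    rw [hval] at h
    refine h.congr_fun fun n => ?_
    have hs : √(β / n.factorial) * √(β / n.factorial) = β / n.factorial :=
      Real.mul_self_sqrt (by positivity)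
    rw [hlam, hφ, hφ, hpre, hρ]
    linear_combination (2 / (β ^ 2 + 1) * ρ ^ n * Real.exp (-δ2 * x ^ 2) *
      H n (√2 * α * β * x) * Real.exp (-δ2 * y ^ 2) * H n (√2 * α * β * y)) * hs
  exact ⟨hS.summable.abs, hS.tsum_eq⟩
end
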